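/- Let A(x) ∈ M_{L×N}(ℤ[x]) with A(x) = A_0 + xA_1 + ⋯ + x^D A_D satisfy: (a) the only w ∈ ℚ^N with A_*(x)w identically zero is w = 0, and (b) for all v ∈ ℚ^L and w ∈ ℚ^N, if v·A_d w = 0 for every d = 1, …, D then v·A_0 w = 0. If X ⊂ 𝕋^N is an infinite subset, then the topological closure of the union ⋃_{n=1}^∞ A(n)X in 𝕋^L contains a translate of a subtorus of 𝕋^L. -/

import Mathlib

open scoped BigOperators
open Matrix

/-- The one-dimensional torus `𝕋 = ℝ/ℤ`. -/
abbrev Torus1 := AddCircle (1 : ℝ)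

/-- Action of an `L × N` integer matrix on the torus `𝕋^N`, by left multiplication. -/
noncomputable def torusAct {L N : ℕ} (A : Matrix (Fin L) (Fin N) ℤ) (x : Fin N → Torus1) :
    Fin L → Torus1 :=
  fun i => ∑ j, A i j • x j

/-- `Y` is `ε`-dense in the full torus `𝕋^L`: every point of `𝕋^L` is within distance `ε`
of some element of `Y` in every coordinate. -/
def EpsDense {L : ℕ} (Y : Set (Fin L → Torus1)) (ε : ℝ) : Prop :=
  ∀ t : Fin L → Torus1, ∃ y ∈ Y, ∀ i, dist (y i) (t i) ≤ ε

/-- `Y` is `ε`-dense in a subset `S` of `𝕋^L`. -/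
def EpsDenseIn {L : ℕ} (Y S : Set (Fin L → Torus1)) (ε : ℝ) : Prop :=
  ∀ s ∈ S, ∃ y ∈ Y, ∀ i, dist (y i) (s i) ≤ ε

/-- A subtorus of `𝕋^L`: a nontrivial closed connected (Lie) subgroup. -/
def IsSubtorus {L : ℕ} (T : AddSubgroup (Fin L → Torus1)) : Prop :=
  IsClosed (T : Set (Fin L → Torus1)) ∧ IsConnected (T : Set (Fin L → Torus1)) ∧ T ≠ ⊥

/-- The translate `t + 𝒯` of a subtorus. -/
def translateOf {L : ℕ} (t : Fin L → Torus1) (T : AddSubgroup (Fin L → Torus1)) :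
    Set (Fin L → Torus1) :=
  (fun y => t + y) '' (T : Set (Fin L → Torus1))

/-- Evaluation at an integer `n` of the matrix of polynomials
`A(x) = A 0 + x • A 1 + ⋯ + x^D • A D`. -/
def evalMat {L N D : ℕ} (A : Fin (D + 1) → Matrix (Fin L) (Fin N) ℤ) (n : ℤ) :
    Matrix (Fin L) (Fin N) ℤ :=
  ∑ d : Fin (D + 1), n ^ (d : ℕ) • A d

/-- Condition (a): the columns of the non-constant part `A_*(x)` are `ℚ`-linearly
independent, i.e. the only `w ∈ ℚ^N` with `A_*(x) w ≡ 0` is `w = 0`. -/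
def CondA {L N D : ℕ} (A : Fin (D + 1) → Matrix (Fin L) (Fin N) ℤ) : Prop :=
  ∀ w : Fin N → ℚ,
    (∀ d : Fin (D + 1), d ≠ 0 → ((A d).map ((↑) : ℤ → ℚ)).mulVec w = 0) → w = 0

/-- Condition (b): whenever `v ⬝ A_d w = 0` for all `d = 1, …, D`, also `v ⬝ A_0 w = 0`. -/
def CondB {L N D : ℕ} (A : Fin (D + 1) → Matrix (Fin L) (Fin N) ℤ) : Prop :=
  ∀ (v : Fin L → ℚ) (w : Fin N → ℚ),
    (∀ d : Fin (D + 1), d ≠ 0 → v ⬝ᵥ ((A d).map ((↑) : ℤ → ℚ)).mulVec w = 0) →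
    v ⬝ᵥ ((A 0).map ((↑) : ℤ → ℚ)).mulVec w = 0

/-- `‖A_*‖_∞`: the maximum of the absolute values of the integer coefficients appearing
in the non-constant part of `A`. -/
def starNorm {L N D : ℕ} (A : Fin (D + 1) → Matrix (Fin L) (Fin N) ℤ) : ℕ :=
  (Finset.univ.filter (fun d : Fin (D + 1) => d ≠ 0)).sup fun d =>
    Finset.univ.sup fun p : Fin L × Fin N => (A d p.1 p.2).natAbs

open Filter Topology
open scoped ComplexConjugate

namespace PolyTorus

/-- The average of the first `N` values of a sequence. -/
noncomputable def avg (N : ℕ) (u : ℕ → ℂ) : ℂ := (∑ n ∈ Finset.range N, u n) / N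

lemma norm_avg_le {N : ℕ} {u : ℕ → ℂ} {C : ℝ} (hC : 0 ≤ C) (hu : ∀ n, ‖u n‖ ≤ C) :
    ‖avg N u‖ ≤ C := by
  rcases Nat.eq_zero_or_pos N with rfl | hN
  · simpa [avg] using hC
  have hN' : (0 : ℝ) < N := by exact_mod_cast hN
  rw [avg, norm_div, Complex.norm_natCast, div_le_iff₀ hN']
  refine (norm_sum_le_of_le _ fun n _ => hu n).trans ?_
  simp [mul_comm]

lemma avg_sum {ι : Type*} (s : Finset ι) (N : ℕ) (u : ι → ℕ → ℂ) :
    avg N (fun n => ∑ i ∈ s, u i n) = ∑ i ∈ s, avg N (u i) := by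
  simp only [avg]
  rw [Finset.sum_comm, Finset.sum_div]

lemma avg_const_mul (N : ℕ) (c : ℂ) (u : ℕ → ℂ) :
    avg N (fun n => c * u n) = c * avg N u := by
  simp only [avg, ← Finset.mul_sum, mul_div_assoc]

lemma norm_sum_shift_sub_le {u : ℕ → ℂ} (hu : ∀ n, ‖u n‖ ≤ 1) (N h : ℕ) :
    ‖∑ n ∈ Finset.range N, u (n + h) - ∑ n ∈ Finset.range N, u n‖ ≤ 2 * h := by
  induction h with
  | zero => simp
  | succ h ih =>
    have h1 : ∑ n ∈ Finset.range N, u (n + (h + 1)) =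
        ∑ n ∈ Finset.range N, u (n + h) + (u (N + h) - u h) := by
      have e1 := Finset.sum_range_succ (fun n => u (n + h)) N
      have e2 := Finset.sum_range_succ' (fun n => u (n + h)) N
      have e3 : ∀ n, n + (h + 1) = n + 1 + h := fun n => by ring
      simp only [e3]
      simp only [zero_add] at e2
      linear_combination e1 - e2
    have h2 : ‖u (N + h) - u h‖ ≤ 2 := (norm_sub_le _ _).trans (by linarith [hu (N + h), hu h])
    calc _ = ‖(∑ n ∈ Finset.range N, u (n + h) - ∑ n ∈ Finset.range N, u n)
          + (u (N + h) - u h)‖ := by rw [h1]; congr 1; ring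
      _ ≤ 2 * h + 2 := (norm_add_le _ _).trans (add_le_add ih h2)
      _ = _ := by push_cast; ring

lemma norm_avg_shift_sub_le {u : ℕ → ℂ} (hu : ∀ n, ‖u n‖ ≤ 1) (N h : ℕ) :
    ‖avg N (fun n => u (n + h)) - avg N u‖ ≤ 2 * h / N := by
  rw [avg, avg, ← sub_div, norm_div, Complex.norm_natCast]
  gcongr
  exact norm_sum_shift_sub_le hu N h

lemma norm_avg_sq_le (N : ℕ) (u : ℕ → ℂ) :
    ‖avg N u‖ ^ 2 ≤ ‖avg N (fun n => u n * conj (u n))‖ := by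
  rcases Nat.eq_zero_or_pos N with rfl | hN
  · simp [avg]
  have hN' : (0 : ℝ) < N := by exact_mod_cast hN
  have h1 : avg N (fun n => u n * conj (u n)) =
      (((∑ n ∈ Finset.range N, ‖u n‖ ^ 2) / N : ℝ) : ℂ) := by
    simp [avg, Complex.mul_conj, Complex.normSq_eq_norm_sq]
  rw [h1, Complex.norm_real, Real.norm_of_nonneg (by positivity), avg, norm_div,
    Complex.norm_natCast, div_pow, div_le_div_iff₀ (by positivity) hN']
  have h2 : ‖∑ n ∈ Finset.range N, u n‖ ^ 2 ≤ N * ∑ n ∈ Finset.range N, ‖u n‖ ^ 2 := by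
    refine (pow_le_pow_left₀ (norm_nonneg _) (norm_sum_le _ _) 2).trans ?_
    simpa using sq_sum_le_card_mul_sum_sq (s := Finset.range N) (f := fun n => ‖u n‖)
  nlinarith

/-- Van der Corput's lemma, for averages of unimodular sequences along a filter. -/
theorem tendsto_avg_zero_of_correlations {ι : Type*} {ℱ : Filter ι} {N : ι → ℕ}
    (hN : Tendsto N ℱ atTop) {u : ι → ℕ → ℂ} (hu : ∀ i n, ‖u i n‖ ≤ 1)
    (hcor : ∀ h h' : ℕ, h ≠ h' →
      Tendsto (fun i => avg (N i) (fun n => u i (n + h) * conj (u i (n + h')))) ℱ (𝓝 0)) :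
    Tendsto (fun i => avg (N i) (u i)) ℱ (𝓝 0) := by
  have key : ∀ H : ℕ, 0 < H → ∀ ε > 0,
      ∀ᶠ i in ℱ, ‖avg (N i) (u i)‖ ≤ ε + Real.sqrt (1 / H + ε) := by
    intro H hH ε hε
    have hH' : (0 : ℝ) < H := by exact_mod_cast hH
    set w : ι → ℕ → ℂ := fun i n => ∑ h ∈ Finset.range H, u i (n + h) with hw
    have hNr : Tendsto (fun i => (N i : ℝ)) ℱ atTop := tendsto_natCast_atTop_atTop.comp hN
    have h1 : ∀ᶠ i in ℱ, 2 * (H : ℝ) / N i ≤ ε :=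
      (hNr.const_div_atTop (2 * (H : ℝ))).eventually_le_const hε
    have h2 : Tendsto (fun i => ∑ h ∈ Finset.range H, ∑ h' ∈ Finset.range H,
        (if h = h' then 0 else
          ‖avg (N i) (fun n => u i (n + h) * conj (u i (n + h')))‖)) ℱ (𝓝 0) := by
      have hpair : ∀ h h' : ℕ, Tendsto (fun i => if h = h' then (0 : ℝ) else
          ‖avg (N i) (fun n => u i (n + h) * conj (u i (n + h')))‖) ℱ (𝓝 0) := by
        intro h h'
        split_ifs with hh
        · exact tendsto_const_nhds
        · simpa using (hcor h h' hh).norm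
      simpa using tendsto_finsetSum (Finset.range H) fun h _ =>
        tendsto_finsetSum (Finset.range H) fun h' _ => hpair h h'
    have h3 := h2.eventually_le_const (show 0 < (H : ℝ) ^ 2 * ε by positivity)
    filter_upwards [h1, h3] with i hi1 hi3
    have a1 : avg (N i) (w i) = ∑ h ∈ Finset.range H, avg (N i) (fun n => u i (n + h)) :=
      avg_sum _ _ _
    have a2 : ‖avg (N i) (w i) - H * avg (N i) (u i)‖ ≤ H * ε := by
      have : avg (N i) (w i) - H * avg (N i) (u i) =
          ∑ h ∈ Finset.range H, (avg (N i) (fun n => u i (n + h)) - avg (N i) (u i)) := by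
        rw [a1, Finset.sum_sub_distrib]; simp
      rw [this]
      refine (norm_sum_le_of_le (f := _) (n := fun _ => ε) _ fun h hh => ?_).trans ?_
      · refine (norm_avg_shift_sub_le (hu i) _ _).trans (le_trans ?_ hi1)
        have : (h : ℝ) ≤ H := by exact_mod_cast (Finset.mem_range.1 hh).le
        gcongr
      · simp
    have a3 : ‖avg (N i) (w i)‖ ^ 2 ≤ H + H ^ 2 * ε := by
      refine (norm_avg_sq_le _ _).trans ?_
      have e1 : (fun n => w i n * conj (w i n)) = fun n => ∑ h ∈ Finset.range H,
          ∑ h' ∈ Finset.range H, u i (n + h) * conj (u i (n + h')) := by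
        funext n
        simp only [hw, map_sum, Finset.sum_mul_sum]
      rw [e1, avg_sum]
      simp only [avg_sum]
      calc _ ≤ ∑ h ∈ Finset.range H, ∑ h' ∈ Finset.range H,
            ((if h = h' then 1 else 0) + (if h = h' then 0 else
              ‖avg (N i) (fun n => u i (n + h) * conj (u i (n + h')))‖)) := by
            refine norm_sum_le_of_le _ fun h _ => norm_sum_le_of_le _ fun h' _ => ?_
            split_ifs with hh
            · rw [add_zero]
              refine norm_avg_le zero_le_one fun n => ?_
              rw [norm_mul, RCLike.norm_conj]
              exact mul_le_one₀ (hu _ _) (norm_nonneg _) (hu _ _)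
            · simp
        _ ≤ _ := by
            simp only [Finset.sum_add_distrib]
            refine add_le_add ?_ hi3
            simp only [Finset.sum_ite_eq]
            refine (Finset.sum_le_sum (g := fun _ => (1 : ℝ)) fun h _ => ?_).trans (by simp)
            split_ifs
            exact le_rfl
    have a4 : ‖avg (N i) (w i)‖ ≤ H * Real.sqrt (1 / H + ε) := by
      refine abs_le_of_sq_le_sq' (b := H * Real.sqrt (1 / H + ε)) ?_ (by positivity) |>.2
      rw [mul_pow, Real.sq_sqrt (by positivity)]
      refine a3.trans (le_of_eq ?_)
      field_simp
    have a5 : (H : ℝ) * ‖avg (N i) (u i)‖ ≤ H * (ε + Real.sqrt (1 / H + ε)) := by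
      have : (H : ℝ) * ‖avg (N i) (u i)‖ = ‖(H : ℂ) * avg (N i) (u i)‖ := by
        rw [norm_mul, Complex.norm_natCast]
      rw [this]
      have := norm_sub_norm_le ((H : ℂ) * avg (N i) (u i)) (avg (N i) (w i))
      rw [norm_sub_rev] at this
      linarith
    exact le_of_mul_le_mul_left a5 hH'
  rw [Metric.tendsto_nhds]
  intro ε hε
  obtain ⟨H, hH⟩ := exists_nat_gt (1 / (ε ^ 2 / 32))
  have hH0 : (0 : ℝ) < H := lt_trans (by positivity) hH
  have hH1 : 1 / (H : ℝ) < ε ^ 2 / 32 := by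
    rw [div_lt_iff₀ (by positivity)] at hH ⊢
    linarith
  set η := min (ε / 4) (ε ^ 2 / 32) with hη
  have hη0 : 0 < η := by positivity
  filter_upwards [key H (by exact_mod_cast hH0) η hη0] with i hi
  rw [dist_zero_right]
  have b1 : η ≤ ε / 4 := min_le_left _ _
  have b2 : η ≤ ε ^ 2 / 32 := min_le_right _ _
  have b3 : Real.sqrt (1 / H + η) ≤ ε / 4 := by
    rw [Real.sqrt_le_iff]
    exact ⟨by positivity, by nlinarith⟩
  linarith

/-- The standard character of `ℝ/ℤ`. -/
noncomputable def e (x : Torus1) : ℂ := (AddCircle.toCircle x : ℂ)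

lemma e_add (x y : Torus1) : e (x + y) = e x * e y := by
  simp [e, AddCircle.toCircle_add]

lemma e_zero : e 0 = 1 := by simp [e]

lemma norm_e (x : Torus1) : ‖e x‖ = 1 := Circle.norm_coe _

lemma conj_e (x : Torus1) : conj (e x) = e (-x) := by
  rw [e, e, AddCircle.toCircle_neg, Circle.coe_inv_eq_conj]

lemma e_sub (x y : Torus1) : e (x - y) = e x * conj (e y) := by
  rw [sub_eq_add_neg, e_add, conj_e]

lemma e_nsmul (n : ℕ) (x : Torus1) : e (n • x) = e x ^ n := by
  induction n with
  | zero => simp [e_zero]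
  | succ n ih => rw [succ_nsmul, e_add, ih, pow_succ]

lemma e_eq_one_iff {x : Torus1} : e x = 1 ↔ x = 0 := by
  refine ⟨fun h => ?_, fun h => h ▸ e_zero⟩
  apply AddCircle.injective_toCircle one_ne_zero
  simpa [e, Circle.ext_iff] using h

lemma continuous_e : Continuous e :=
  continuous_subtype_val.comp AddCircle.continuous_toCircle

lemma e_sum {ι : Type*} (s : Finset ι) (x : ι → Torus1) :
    e (∑ i ∈ s, x i) = ∏ i ∈ s, e (x i) := by
  classical
  induction s using Finset.induction_on with
  | empty => simp [e_zero]
  | insert a s ha ih => rw [Finset.sum_insert ha, Finset.prod_insert ha, e_add, ih]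

lemma fwdDiff_iter_sub {G : Type*} [AddCommGroup G] (f g : ℕ → G) (D : ℕ) :
    (fwdDiff 1)^[D] (f - g) = (fwdDiff 1)^[D] f - (fwdDiff 1)^[D] g := by
  rw [eq_sub_iff_add_eq, ← fwdDiff_iter_add, sub_add_cancel]

lemma eq_add_nsmul_of_fwdDiff {G : Type*} [AddCommGroup G] {f : ℕ → G} {θ : G}
    (h : ∀ n, fwdDiff 1 f n = θ) (n : ℕ) : f n = f 0 + n • θ := by
  induction n with
  | zero => simp
  | succ n ih =>
    have := h n
    rw [fwdDiff, sub_eq_iff_eq_add] at this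
    rw [this, ih, succ_nsmul]; abel

/-- Weyl's theorem, uniformly in families of polynomial phases given by iterated differences. -/
theorem tendsto_avg_of_fwdDiff {𝒰 : Filter ℕ} (D : ℕ) (f : ℕ → ℕ → Torus1) (θ : ℕ → Torus1)
    (hθ : ∀ M : ℤ, M ≠ 0 → ∀ᶠ k in 𝒰, M • θ k ≠ 0)
    (hf : ∀ᶠ k in 𝒰, ∀ n, (fwdDiff 1)^[D + 1] (f k) n = θ k) :
    Tendsto (fun p : ℕ × ℕ => avg p.2 (fun n => e (f p.1 n))) (𝒰.curry atTop) (𝓝 0) := by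
  induction D generalizing f θ with
  | zero =>
    rw [Metric.tendsto_nhds]
    intro ε hε
    rw [Filter.eventually_curry_iff]
    filter_upwards [hf, hθ 1 one_ne_zero] with k hk hk0
    rw [one_smul] at hk0
    have hne : e (θ k) - 1 ≠ 0 := sub_ne_zero.2 fun h => hk0 (e_eq_one_iff.1 h)
    have hlim : Tendsto (fun N : ℕ => 2 / ‖e (θ k) - 1‖ / (N : ℝ)) atTop (𝓝 0) :=
      tendsto_natCast_atTop_atTop.const_div_atTop _
    filter_upwards [hlim.eventually_lt_const hε] with N hN
    rw [dist_zero_right]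
    refine lt_of_le_of_lt ?_ hN
    have : ∀ n, e (f k n) = e (f k 0) * e (θ k) ^ n := fun n => by
      rw [eq_add_nsmul_of_fwdDiff hk n, e_add, e_nsmul]
    rw [funext this, avg_const_mul, norm_mul, norm_e, one_mul, avg, norm_div, Complex.norm_natCast,
      geom_sum_eq (sub_ne_zero.1 hne), norm_div]
    gcongr
    refine (norm_sub_le _ _).trans ?_
    rw [norm_pow, norm_e]; norm_num
  | succ D ih =>
    refine tendsto_avg_zero_of_correlations (N := fun p : ℕ × ℕ => p.2) ?_
      (fun i n => (norm_e _).le) ?_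
    · rw [Filter.tendsto_def]
      intro s hs
      exact Filter.eventually_curry_iff.2 (Filter.Eventually.of_forall fun _ => hs)
    intro h h' hh
    simp only [← e_sub]
    refine ih (fun k n => f k (n + h) - f k (n + h')) (fun k => ((h : ℤ) - h') • θ k) ?_ ?_
    · intro M hM
      have : M * ((h : ℤ) - h') ≠ 0 := by
        refine mul_ne_zero hM ?_
        rw [sub_ne_zero]; exact_mod_cast hh
      filter_upwards [hθ _ this] with k hk
      rwa [← mul_smul]
    · filter_upwards [hf] with k hk n
      have e1 : ∀ n, (fwdDiff 1)^[D + 1] (f k) n = (fwdDiff 1)^[D + 1] (f k) 0 + n • θ k := by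
        refine eq_add_nsmul_of_fwdDiff fun n => ?_
        rw [← hk n, Function.iterate_succ_apply' _ (D + 1)]
      have e2 : (fun n => f k (n + h) - f k (n + h')) =
        (fun n => f k (n + h)) - (fun n => f k (n + h')) := rfl
      rw [e2, fwdDiff_iter_sub]
      simp only [Pi.sub_apply, fwdDiff_iter_comp_add]
      rw [e1, e1 (n + h')]
      simp only [sub_smul, add_smul, natCast_zsmul]
      abel

/-- The integer character `x ↦ m · x` of a torus. -/
noncomputable def pair {n : ℕ} (m : Fin n → ℤ) (x : Fin n → Torus1) : Torus1 := ∑ i, m i • x i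

section pair

variable {n : ℕ} (m m' : Fin n → ℤ) (x y : Fin n → Torus1)

lemma pair_zero_left : pair 0 x = 0 := by simp [pair]

lemma pair_zero_right : pair m 0 = 0 := by simp [pair]

lemma pair_add_left : pair (m + m') x = pair m x + pair m' x := by
  simp [pair, add_smul, Finset.sum_add_distrib]

lemma pair_neg_left : pair (-m) x = -pair m x := by
  simp [pair]

lemma pair_sub_left : pair (m - m') x = pair m x - pair m' x := by
  rw [sub_eq_add_neg, pair_add_left, pair_neg_left, ← sub_eq_add_neg]

lemma pair_smul_left (q : ℤ) : pair (q • m) x = q • pair m x := by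
  simp [pair, Finset.smul_sum, mul_smul]

lemma pair_add_right : pair m (x + y) = pair m x + pair m y := by
  simp [pair, Finset.sum_add_distrib]

lemma pair_sub_right : pair m (x - y) = pair m x - pair m y := by
  simp [pair, smul_sub]

lemma pair_single_one (j : Fin n) : pair (Pi.single j 1) x = x j := by
  rw [pair, Finset.sum_eq_single j]
  · simp
  · intro i _ hi; simp [hi]
  · simp

lemma continuous_pair : Continuous (pair m) :=
  continuous_finsetSum _ fun i _ => (continuous_apply i).zsmul (m i)

lemma pair_torusAct {L : ℕ} (v : Fin L → ℤ) (A : Matrix (Fin L) (Fin n) ℤ) :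
    pair v (torusAct A x) = pair (v ᵥ* A) x := by
  simp only [pair, torusAct, Matrix.vecMul, dotProduct, Finset.smul_sum, Finset.sum_smul, mul_smul]
  exact Finset.sum_comm

lemma pair_torusAct_evalMat {L D : ℕ} (v : Fin L → ℤ)
    (A : Fin (D + 1) → Matrix (Fin L) (Fin n) ℤ) (a : ℤ) :
    pair v (torusAct (evalMat A a) x) =
      ∑ d : Fin (D + 1), a ^ (d : ℕ) • pair (v ᵥ* A d) x := by
  have : v ᵥ* evalMat A a = ∑ d : Fin (D + 1), a ^ (d : ℕ) • (v ᵥ* A d) := by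
    rw [evalMat, Matrix.vecMul_sum]
    simp only [Matrix.vecMul_smul]
  rw [pair_torusAct, this]
  simp only [← pair_smul_left]
  induction (Finset.univ : Finset (Fin (D + 1))) using Finset.induction_on with
  | empty => simp [pair_zero_left]
  | insert a s ha ih => rw [Finset.sum_insert ha, Finset.sum_insert ha, pair_add_left, ih]

end pair

/-- A vector outside a saturated subgroup of `ℤ^n` is separated from it by a rational functional. -/
lemma exists_rat_separating {n : ℕ} (S : AddSubgroup (Fin n → ℤ))
    (hS : ∀ q : ℤ, q ≠ 0 → ∀ m, q • m ∈ S → m ∈ S) {m : Fin n → ℤ} (hm : m ∉ S) :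
    ∃ v : Fin n → ℚ, (∀ s ∈ S, ∑ i, (s i : ℚ) * v i = 0) ∧ ∑ i, (m i : ℚ) * v i ≠ 0 := by
  let c : (Fin n → ℤ) → (Fin n → ℚ) := fun s i => s i
  have hmem : c m ∉ Submodule.span ℚ (c '' (S : Set (Fin n → ℤ))) := by
    intro hc
    have hspan : ∀ y ∈ Submodule.span ℚ (c '' (S : Set (Fin n → ℤ))),
        ∃ q : ℤ, q ≠ 0 ∧ ∃ s ∈ S, (q : ℚ) • y = c s := by
      intro y hy
      induction hy using Submodule.span_induction with
      | mem x hx =>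
        obtain ⟨s, hs, rfl⟩ := hx
        exact ⟨1, one_ne_zero, s, hs, by simp⟩
      | zero => exact ⟨1, one_ne_zero, 0, S.zero_mem, by ext; simp [c]⟩
      | add x y _ _ hx hy =>
        obtain ⟨q, hq, s, hs, h1⟩ := hx
        obtain ⟨q', hq', s', hs', h2⟩ := hy
        refine ⟨q * q', mul_ne_zero hq hq', q' • s + q • s',
          S.add_mem (S.zsmul_mem hs _) (S.zsmul_mem hs' _), ?_⟩
        ext i
        have e1 := congrFun h1 i
        have e2 := congrFun h2 i
        simp only [c, Pi.smul_apply, Pi.add_apply, smul_eq_mul] at e1 e2 ⊢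
        push_cast
        linear_combination (q' : ℚ) * e1 + (q : ℚ) * e2
      | smul a x _ hx =>
        obtain ⟨q, hq, s, hs, h1⟩ := hx
        refine ⟨a.den * q, mul_ne_zero (by exact_mod_cast a.den_nz) hq, a.num • s,
          S.zsmul_mem hs _, ?_⟩
        ext i
        have e1 := congrFun h1 i
        have e2 : (a.den : ℚ) * a = a.num := by rw [mul_comm]; exact Rat.mul_den_eq_num a
        simp only [c, Pi.smul_apply, smul_eq_mul] at e1 ⊢
        push_cast
        linear_combination (a.num : ℚ) * e1 + (q * x i : ℚ) * e2
    obtain ⟨q, hq, s, hs, h⟩ := hspan _ hc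
    refine hm (hS q hq m ?_)
    have : q • m = s := by
      ext i
      have := congrFun h i
      simp only [c, Pi.smul_apply, smul_eq_mul] at this ⊢
      exact_mod_cast this
    rwa [this]
  obtain ⟨f, hf, hle⟩ := Submodule.exists_le_ker_of_notMem hmem
  have hsum : ∀ s : Fin n → ℤ, ∑ i, (s i : ℚ) * f (Pi.single i 1) = f (c s) := by
    intro s
    rw [LinearMap.pi_apply_eq_sum_univ f (c s)]
    refine Finset.sum_congr rfl fun i _ => ?_
    rw [smul_eq_mul]
    congr 2
    ext j
    simp [Pi.single_apply, eq_comm]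
  refine ⟨fun i => f (Pi.single i 1), fun s hs => ?_, ?_⟩
  · rw [hsum]
    exact hle (Submodule.subset_span ⟨s, hs, rfl⟩)
  · rw [hsum]
    exact hf

/-- A proper saturated subgroup of characters vanishes on some subtorus. -/
lemma exists_subtorus {L : ℕ} (S : AddSubgroup (Fin L → ℤ))
    (hS : ∀ q : ℤ, q ≠ 0 → ∀ m, q • m ∈ S → m ∈ S) {m : Fin L → ℤ} (hm : m ∉ S) :
    ∃ T : AddSubgroup (Fin L → Torus1), IsSubtorus T ∧ ∀ t ∈ T, ∀ s ∈ S, pair s t = 0 := by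
  obtain ⟨v, hv, hmv⟩ := exists_rat_separating S hS hm
  let φ : ℝ →+ (Fin L → Torus1) :=
    { toFun := fun r i => ((r * (v i : ℝ) : ℝ) : Torus1)
      map_zero' := by ext i; simp
      map_add' := fun a b => by ext i; simp [add_mul] }
  have hφc : Continuous φ :=
    continuous_pi fun i => (AddCircle.continuous_mk' 1).comp (continuous_mul_const _)
  have hφ : ∀ (s : Fin L → ℤ) (r : ℝ),
      pair s (φ r) = ((r * ((∑ i, (s i : ℚ) * v i : ℚ) : ℝ) : ℝ) : Torus1) := by
    intro s r
    have h1 : r * ((∑ i, (s i : ℚ) * v i : ℚ) : ℝ) = ∑ i, s i • (r * (v i : ℝ)) := by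
      push_cast
      rw [Finset.mul_sum]
      refine Finset.sum_congr rfl fun i _ => ?_
      rw [zsmul_eq_mul]; ring
    rw [h1]
    change ∑ i, s i • ((r * (v i : ℝ) : ℝ) : Torus1) = QuotientAddGroup.mk' _ _
    rw [map_sum]
    simp only [map_zsmul]
    rfl
  refine ⟨φ.range.topologicalClosure, ⟨?_, ?_, ?_⟩, ?_⟩
  · exact AddSubgroup.isClosed_topologicalClosure _
  · rw [AddSubgroup.topologicalClosure_coe, AddMonoidHom.coe_range]
    exact (isConnected_range hφc).closure
  · intro hbot
    have h1 : φ (1 / (2 * ((∑ i, (m i : ℚ) * v i : ℚ) : ℝ))) = 0 := by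
      have := AddSubgroup.le_topologicalClosure φ.range
        (⟨_, rfl⟩ : φ (1 / (2 * ((∑ i, (m i : ℚ) * v i : ℚ) : ℝ))) ∈ φ.range)
      rwa [hbot, AddSubgroup.mem_bot] at this
    have h2 := hφ m (1 / (2 * ((∑ i, (m i : ℚ) * v i : ℚ) : ℝ)))
    have hne : ((∑ i, (m i : ℚ) * v i : ℚ) : ℝ) ≠ 0 := by exact_mod_cast hmv
    have h3 : 1 / (2 * ((∑ i, (m i : ℚ) * v i : ℚ) : ℝ)) * ((∑ i, (m i : ℚ) * v i : ℚ) : ℝ)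
        = 1 / 2 := by field_simp
    rw [h1, pair_zero_right, h3, eq_comm, AddCircle.coe_eq_zero_iff] at h2
    obtain ⟨q, hq⟩ := h2
    have h4 : (2 * q : ℝ) = 1 := by
      simp only [zsmul_eq_mul, mul_one] at hq
      rw [hq]; norm_num
    have h5 : 2 * q = 1 := by exact_mod_cast h4
    omega
  · intro t ht s hs
    have hcl : IsClosed {t | pair s t = 0} :=
      isClosed_eq (continuous_pair s) continuous_const
    refine closure_minimal ?_ hcl ht
    rintro _ ⟨r, rfl⟩
    change pair s (φ r) = 0
    rw [hφ, hv s hs]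
    simp

lemma norm_one_add_lt_two {z : ℂ} (hz : ‖z‖ = 1) (h1 : z ≠ 1) : ‖1 + z‖ < 2 := by
  have h2 : z.re ^ 2 + z.im ^ 2 = 1 := by
    have := Complex.sq_norm z
    rw [hz, Complex.normSq_apply] at this
    linarith
  have h3 : z.re < 1 := by
    refine lt_of_le_of_ne (by nlinarith [sq_nonneg z.im]) fun h => h1 ?_
    have : z.im = 0 := by
      rw [h] at h2
      nlinarith
    exact Complex.ext h this
  refine lt_of_pow_lt_pow_left₀ 2 (by norm_num) ?_
  rw [Complex.sq_norm, Complex.normSq_apply]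
  simp
  nlinarith

lemma norm_half_one_add_e_le (x : Torus1) : ‖(1 + e x) / 2‖ ≤ 1 := by
  rw [norm_div]
  have := norm_add_le 1 (e x)
  rw [norm_e, norm_one] at this
  rw [show ‖(2 : ℂ)‖ = 2 by simp]
  linarith

lemma norm_prod_half_one_add_e_lt {L : ℕ} {x : Fin L → Torus1} (hx : x ≠ 0) :
    ‖∏ i, (1 + e (x i)) / 2‖ < 1 := by
  obtain ⟨j, hj⟩ := Function.ne_iff.1 hx
  rw [← Finset.mul_prod_erase _ _ (Finset.mem_univ j), norm_mul, norm_prod]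
  have h1 : ‖(1 + e (x j)) / 2‖ < 1 := by
    rw [norm_div, show ‖(2 : ℂ)‖ = 2 by simp, div_lt_one (by norm_num)]
    exact norm_one_add_lt_two (norm_e _) fun h => hj (e_eq_one_iff.1 h)
  have h2 : ∏ i ∈ Finset.univ.erase j, ‖(1 + e (x i)) / 2‖ ≤ 1 :=
    Finset.prod_le_one (fun _ _ => norm_nonneg _) fun _ _ => norm_half_one_add_e_le _
  exact mul_lt_one_of_nonneg_of_lt_one_left (norm_nonneg _) h1 h2

lemma exists_bound_away_from_zero (L : ℕ) {δ : ℝ} (hδ : 0 < δ) :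
    ∃ ρ : ℝ, 0 < ρ ∧ ρ < 1 ∧ ∀ x : Fin L → Torus1, δ ≤ dist x 0 →
      ‖∏ i, (1 + e (x i)) / 2‖ ≤ ρ := by
  set K : Set (Fin L → Torus1) := {x | δ ≤ dist x 0} with hK
  have hKc : IsCompact K :=
    (isClosed_le continuous_const (continuous_id.dist continuous_const)).isCompact
  have hcont : Continuous fun x : Fin L → Torus1 => ‖∏ i, (1 + e (x i)) / 2‖ := by
    refine (continuous_finsetProd _ fun i _ => ?_).norm
    exact (continuous_const.add (continuous_e.comp (continuous_apply i))).div_const _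
  rcases K.eq_empty_or_nonempty with h0 | hne
  · refine ⟨1 / 2, by norm_num, by norm_num, fun x hx => ?_⟩
    have : x ∈ K := hx
    simp [h0] at this
  · obtain ⟨z, hz, hmax⟩ := hKc.exists_isMaxOn hne hcont.continuousOn
    have hz0 : z ≠ 0 := by
      rintro rfl
      have : δ ≤ dist (0 : Fin L → Torus1) 0 := hz
      rw [dist_self] at this
      linarith
    refine ⟨max (1 / 2) ‖∏ i, (1 + e (z i)) / 2‖, by positivity,
      max_lt (by norm_num) (norm_prod_half_one_add_e_lt hz0), fun x hx => ?_⟩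
    exact (hmax (show x ∈ K from hx)).trans (le_max_right _ _)

/-- A trigonometric polynomial with nonnegative coefficients whose square is smaller away from the
origin than the sum of the squares of its coefficients. -/
lemma exists_peak (L : ℕ) {δ : ℝ} (hδ : 0 < δ) :
    ∃ (F : Finset (Fin L → ℕ)) (b : (Fin L → ℕ) → ℝ) (C : ℝ), (∀ m, 0 ≤ b m) ∧ 0 ≤ C ∧
      C < ∑ m ∈ F, b m ^ 2 ∧ ∀ x : Fin L → Torus1, δ ≤ dist x 0 →
        ‖∑ m ∈ F, (b m : ℂ) * e (pair (fun i => (m i : ℤ)) x)‖ ^ 2 ≤ C := by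
  obtain ⟨ρ, hρ0, hρ1, hρ⟩ := exists_bound_away_from_zero L hδ
  set σ := ρ ^ 2 with hσ
  have hσ0 : 0 < σ := by positivity
  have hσ1 : σ < 1 := by rw [hσ]; nlinarith
  obtain ⟨r, hr⟩ : ∃ r : ℕ, ((r + 1 : ℕ) : ℝ) ^ L * σ ^ (r + 1) < σ := by
    have h1 := tendsto_pow_const_mul_const_pow_of_abs_lt_one L
      (show |σ| < 1 by rwa [abs_of_pos hσ0])
    exact (((tendsto_add_atTop_iff_nat 1).2 h1).eventually_lt_const hσ0).exists
  set F : Finset (Fin L → ℕ) := Fintype.piFinset fun _ => Finset.range (r + 1) with hF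
  set b : (Fin L → ℕ) → ℝ := fun m => ∏ i, ((r.choose (m i) : ℝ) / 2 ^ r) with hb
  have hexp : ∀ x : Fin L → Torus1,
      ∑ m ∈ F, (b m : ℂ) * e (pair (fun i => (m i : ℤ)) x) =
        (∏ i, (1 + e (x i)) / 2) ^ r := by
    intro x
    rw [← Finset.prod_pow]
    have h1 : ∀ i, ((1 + e (x i)) / 2) ^ r =
        ∑ k ∈ Finset.range (r + 1), ((r.choose k : ℂ) / 2 ^ r) * e (x i) ^ k := by
      intro i
      rw [div_pow, add_comm, add_pow, Finset.sum_div]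
      refine Finset.sum_congr rfl fun k _ => ?_
      rw [one_pow]; ring
    simp only [h1]
    rw [Finset.prod_univ_sum]
    refine Finset.sum_congr rfl fun m _ => ?_
    rw [Finset.prod_mul_distrib, pair, e_sum]
    congr 1
    · simp [hb]
    · simp only [natCast_zsmul, e_nsmul]
  have hsum : ∑ m ∈ F, b m = 1 := by
    have := hexp 0
    simp only [pair_zero_right, e_zero, mul_one, Pi.zero_apply] at this
    norm_num at this
    exact_mod_cast this
  refine ⟨F, b, σ ^ r, fun m => Finset.prod_nonneg fun i _ => by positivity, by positivity,
    ?_, fun x hx => ?_⟩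
  · have hcs := sq_sum_le_card_mul_sum_sq (s := F) (f := b)
    have hcard : (F.card : ℝ) = ((r + 1 : ℕ) : ℝ) ^ L := by
      simp [hF, Fintype.card_piFinset]
    rw [hsum, hcard, one_pow] at hcs
    have hpos : 0 < ((r + 1 : ℕ) : ℝ) ^ L := by positivity
    have h2 : ((r + 1 : ℕ) : ℝ) ^ L * σ ^ r < 1 := by
      rw [pow_succ, ← mul_assoc] at hr
      exact (mul_lt_iff_lt_one_left hσ0).1 hr
    exact lt_of_mul_lt_mul_left (h2.trans_le hcs) hpos.le
  · rw [hexp, norm_pow, ← pow_mul, mul_comm r 2, pow_mul]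
    exact pow_le_pow_left₀ (by positivity) (pow_le_pow_left₀ (norm_nonneg _) (hρ x hx) 2) r

lemma fwdDiff_iter_zpow_smul (a : ℤ) (θ : Torus1) {d D : ℕ} (hd : d ≤ D) (n : ℕ) :
    (fwdDiff 1)^[D] (fun n : ℕ => (a * ((n : ℤ) + 1)) ^ d • θ) n =
      if d = D then ((D.factorial : ℤ) * a ^ D) • θ else 0 := by
  have h1 : (fwdDiff 1)^[D] (fun n : ℕ => (a * ((n : ℤ) + 1)) ^ d • θ) n =
      (a ^ d * (fwdDiff 1)^[D] (fun r : ℤ => r ^ d) ((n : ℤ) + 1)) • θ := by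
    rw [fwdDiff_iter_eq_sum_shift, fwdDiff_iter_eq_sum_shift, Finset.mul_sum, Finset.sum_smul]
    refine Finset.sum_congr rfl fun k _ => ?_
    rw [← mul_smul]
    congr 1
    simp only [smul_eq_mul, mul_one, nsmul_eq_mul]
    push_cast
    rw [mul_pow, show (n : ℤ) + 1 + k = n + k + 1 by ring]
    ring
  rw [h1]
  split_ifs with h
  · subst h
    rw [fwdDiff_iter_eq_factorial, mul_comm]
    rfl
  · rw [fwdDiff_iter_pow_eq_zero_of_lt (lt_of_le_of_ne hd h)]
    simp

section density

variable {L N D : ℕ} (𝒰 : Ultrafilter ℕ) (x : ℕ → Fin N → Torus1)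
  (A : Fin (D + 1) → Matrix (Fin L) (Fin N) ℤ)

/-- The characters whose values on the sequence `x` have bounded order along `𝒰`. -/
def boundedOrder : AddSubgroup (Fin N → ℤ) where
  carrier := {r | ∃ M : ℕ, 0 < M ∧ ∀ᶠ k in 𝒰, M • pair r (x k) = 0}
  zero_mem' := ⟨1, one_pos, by simp [pair_zero_left]⟩
  add_mem' := by
    rintro r s ⟨M, hM, h⟩ ⟨M', hM', h'⟩
    refine ⟨M * M', Nat.mul_pos hM hM', ?_⟩
    filter_upwards [h, h'] with k hk hk'
    rw [pair_add_left, smul_add, mul_comm, mul_smul, hk, mul_comm, mul_smul, hk']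
    simp
  neg_mem' := by
    rintro r ⟨M, hM, h⟩
    refine ⟨M, hM, ?_⟩
    filter_upwards [h] with k hk
    rw [pair_neg_left, smul_neg, hk, neg_zero]

lemma mem_boundedOrder_of_zsmul {r : Fin N → ℤ} {M : ℤ} (hM : M ≠ 0)
    (h : ∀ᶠ k in 𝒰, M • pair r (x k) = 0) : r ∈ boundedOrder 𝒰 x := by
  refine ⟨M.natAbs, Int.natAbs_pos.2 hM, ?_⟩
  filter_upwards [h] with k hk
  rw [← natCast_zsmul]
  rcases Int.natAbs_eq M with h' | h'
  · rwa [← h']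
  · rw [show (M.natAbs : ℤ) = -M by omega, neg_smul, hk, neg_zero]

lemma boundedOrder_saturated (q : ℤ) (hq : q ≠ 0) (r : Fin N → ℤ)
    (h : q • r ∈ boundedOrder 𝒰 x) : r ∈ boundedOrder 𝒰 x := by
  obtain ⟨M, hM, h⟩ := h
  refine mem_boundedOrder_of_zsmul 𝒰 x (M := M * q)
    (mul_ne_zero (by exact_mod_cast hM.ne') hq) ?_
  filter_upwards [h] with k hk
  rwa [mul_smul, ← pair_smul_left, natCast_zsmul]

/-- The characters along which every nonconstant coefficient of `n ↦ A(n) x_k` has bounded order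
along `𝒰`. -/
def coeffBounded : AddSubgroup (Fin L → ℤ) where
  carrier := {m | ∀ d, d ≠ 0 → m ᵥ* A d ∈ boundedOrder 𝒰 x}
  zero_mem' := fun d _ => by rw [Matrix.zero_vecMul]; exact AddSubgroup.zero_mem _
  add_mem' := fun h h' d hd => by
    rw [Matrix.add_vecMul]; exact AddSubgroup.add_mem _ (h d hd) (h' d hd)
  neg_mem' := fun h d hd => by
    rw [Matrix.neg_vecMul]; exact AddSubgroup.neg_mem _ (h d hd)

lemma mem_coeffBounded {m : Fin L → ℤ} :
    m ∈ coeffBounded 𝒰 x A ↔ ∀ d, d ≠ 0 → m ᵥ* A d ∈ boundedOrder 𝒰 x := Iff.rfl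

lemma coeffBounded_saturated (q : ℤ) (hq : q ≠ 0) (m : Fin L → ℤ)
    (h : q • m ∈ coeffBounded 𝒰 x A) : m ∈ coeffBounded 𝒰 x A := by
  intro d hd
  refine boundedOrder_saturated 𝒰 x q hq _ ?_
  rw [← Matrix.smul_vecMul]
  exact h d hd

lemma eventually_factorial_smul_eq_zero (p : Fin L → ℤ) :
    ∀ᶠ j : ℕ in atTop, ∀ d, p ᵥ* A d ∈ boundedOrder 𝒰 x →
      ∀ᶠ k in 𝒰, (j.factorial : ℤ) • pair (p ᵥ* A d) (x k) = 0 := by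
  rw [eventually_all]
  intro d
  by_cases h : p ᵥ* A d ∈ boundedOrder 𝒰 x
  · obtain ⟨M, hM, hk⟩ := h
    filter_upwards [eventually_ge_atTop M] with j hj _
    obtain ⟨c, hc⟩ := Nat.dvd_factorial hM hj
    filter_upwards [hk] with k hk
    rw [natCast_zsmul, hc, mul_comm, mul_smul, hk, smul_zero]
  · exact Eventually.of_forall fun _ h' => absurd h' h

open scoped Classical in
/-- The averages of a character along the orbits, in the limit. -/
lemma eventually_tendsto_avg {y t : Fin L → Torus1}
    (hy : Tendsto (fun k => torusAct (A 0) (x k)) 𝒰 (𝓝 y))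
    (ht : ∀ m ∈ coeffBounded 𝒰 x A, pair m t = 0) (p : Fin L → ℤ) :
    ∀ᶠ j : ℕ in atTop, (p ∈ coeffBounded 𝒰 x A →
      Tendsto (fun q : ℕ × ℕ => avg q.2 fun n =>
        e (pair p (torusAct (evalMat A (j.factorial * ((n : ℤ) + 1))) (x q.1) - (y + t))))
        ((𝒰 : Filter ℕ).curry atTop) (𝓝 1)) ∧ (p ∉ coeffBounded 𝒰 x A →
      Tendsto (fun q : ℕ × ℕ => avg q.2 fun n =>
        e (pair p (torusAct (evalMat A (j.factorial * ((n : ℤ) + 1))) (x q.1) - (y + t))))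
        ((𝒰 : Filter ℕ).curry atTop) (𝓝 0)) := by
  filter_upwards [eventually_factorial_smul_eq_zero 𝒰 x A p] with j hj
  set a : ℤ := (j.factorial : ℤ) with ha
  have ha0 : a ≠ 0 := by rw [ha]; exact_mod_cast j.factorial_ne_zero
  have hexp : ∀ k n : ℕ, pair p (torusAct (evalMat A (a * ((n : ℤ) + 1))) (x k) - (y + t)) =
      ∑ d : Fin (D + 1), (a * ((n : ℤ) + 1)) ^ (d : ℕ) • pair (p ᵥ* A d) (x k)
        - pair p (y + t) := by
    intro k n
    rw [pair_sub_right, pair_torusAct_evalMat]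
  have hkill : ∀ {c : Torus1} (n : ℕ) {d : ℕ}, d ≠ 0 → a • c = 0 →
      (a * ((n : ℤ) + 1)) ^ d • c = 0 := by
    intro c n d hd hc
    obtain ⟨d, rfl⟩ := Nat.exists_eq_succ_of_ne_zero hd
    rw [Nat.succ_eq_add_one, mul_pow, pow_succ, mul_comm, mul_smul, mul_smul, hc]
    simp
  refine ⟨fun hp => ?_, fun hp => ?_⟩
  · have h0 : Tendsto (fun q : ℕ × ℕ => e (pair p (torusAct (A 0) (x q.1) - y)))
        ((𝒰 : Filter ℕ).curry atTop) (𝓝 1) := by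
      have h1 : Tendsto (fun k => e (pair p (torusAct (A 0) (x k) - y))) 𝒰 (𝓝 1) := by
        have hc : Continuous fun z => e (pair p (z - y)) :=
          continuous_e.comp ((continuous_pair p).comp (continuous_id.sub continuous_const))
        have := (hc.tendsto y).comp hy
        simpa [pair_zero_right, e_zero, Function.comp_def] using this
      exact h1.comp (tendsto_fst.mono_left curry_le_prod)
    refine h0.congr' ?_
    rw [EventuallyEq, eventually_curry_iff]
    have hall : ∀ᶠ k in 𝒰, ∀ d, d ≠ 0 → a • pair (p ᵥ* A d) (x k) = 0 := by
      rw [eventually_all]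
      intro d
      by_cases hd : d = 0
      · exact Eventually.of_forall fun _ h => absurd hd h
      · filter_upwards [hj d (hp d hd)] with k hk _ using hk
    filter_upwards [hall] with k hk
    filter_upwards [eventually_gt_atTop 0] with M hM
    have hM' : (M : ℂ) ≠ 0 := by exact_mod_cast hM.ne'
    have hcst : ∀ n : ℕ, e (pair p (torusAct (evalMat A (a * ((n : ℤ) + 1))) (x k) - (y + t))) =
        e (pair p (torusAct (A 0) (x k) - y)) := by
      intro n
      rw [hexp, Finset.sum_eq_single 0]
      · rw [pair_add_right, ht p hp, pair_sub_right, pair_torusAct]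
        simp
      · intro d _ hd
        exact hkill n (fun h => hd (Fin.ext h)) (hk d hd)
      · simp
    simp only [hcst, avg, Finset.sum_const, Finset.card_range, nsmul_eq_mul]
    rw [mul_div_cancel_left₀ _ hM']
  · have hex : (Finset.univ.filter fun d : Fin (D + 1) =>
        d ≠ 0 ∧ p ᵥ* A d ∉ boundedOrder 𝒰 x).Nonempty := by
      rw [mem_coeffBounded] at hp
      push Not at hp
      obtain ⟨d, hd⟩ := hp
      exact ⟨d, by simpa using hd⟩
    obtain ⟨d₀, hd₀, hmax⟩ := Finset.exists_max_image _ id hex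
    simp only [Finset.mem_filter, Finset.mem_univ, true_and, id] at hd₀ hmax
    have hd₀' : (d₀ : ℕ) ≠ 0 := fun h => hd₀.1 (Fin.ext h)
    obtain ⟨E, hE⟩ := Nat.exists_eq_succ_of_ne_zero hd₀'
    rw [Nat.succ_eq_add_one] at hE
    refine tendsto_avg_of_fwdDiff E
      (fun k n => pair p (torusAct (evalMat A (a * ((n : ℤ) + 1))) (x k) - (y + t)))
      (fun k => (((d₀ : ℕ).factorial : ℤ) * a ^ (d₀ : ℕ)) • pair (p ᵥ* A d₀) (x k)) ?_ ?_
    · intro M hM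
      refine Ultrafilter.eventually_not.2 fun h => hd₀.2 ?_
      refine mem_boundedOrder_of_zsmul 𝒰 x
        (M := M * (((d₀ : ℕ).factorial : ℤ) * a ^ (d₀ : ℕ))) ?_ ?_
      · exact mul_ne_zero hM (mul_ne_zero (by exact_mod_cast Nat.factorial_ne_zero _)
          (pow_ne_zero _ ha0))
      · filter_upwards [h] with k hk
        rwa [mul_smul]
    · have hall : ∀ᶠ k in 𝒰, ∀ d, d₀ < d → a • pair (p ᵥ* A d) (x k) = 0 := by
        rw [eventually_all]
        intro d
        by_cases hd : d₀ < d
        · have : p ᵥ* A d ∈ boundedOrder 𝒰 x := by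
            by_contra hb
            exact absurd (hmax d ⟨(Fin.pos_of_ne_zero hd₀.1 |>.trans hd).ne', hb⟩) (not_le.2 hd)
          filter_upwards [hj d this] with k hk _ using hk
        · exact Eventually.of_forall fun _ h => absurd h hd
      filter_upwards [hall] with k hk n
      have hfun : (fun n : ℕ =>
          pair p (torusAct (evalMat A (a * ((n : ℤ) + 1))) (x k) - (y + t))) =
          (∑ d : Fin (D + 1), fun n : ℕ => (a * ((n : ℤ) + 1)) ^ (d : ℕ) • pair (p ᵥ* A d) (x k))
          - fun n : ℕ => (a * ((n : ℤ) + 1)) ^ 0 • pair p (y + t) := by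
        funext n
        rw [hexp]
        simp
      rw [hfun, fwdDiff_iter_sub, fwdDiff_iter_finsetSum, Pi.sub_apply, Finset.sum_apply,
        fwdDiff_iter_zpow_smul _ _ (Nat.zero_le _), if_neg (Nat.succ_ne_zero E).symm, sub_zero,
        Finset.sum_eq_single d₀]
      · rw [fwdDiff_iter_zpow_smul _ _ hE.le, if_pos hE, hE]
      · intro d _ hd
        rcases lt_or_gt_of_ne hd with h | h
        · have h' : (d : ℕ) < E + 1 := by rw [← hE]; exact h
          rw [fwdDiff_iter_zpow_smul _ _ h'.le, if_neg h'.ne]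
        · have : (fun n : ℕ => (a * ((n : ℤ) + 1)) ^ (d : ℕ) • pair (p ᵥ* A d) (x k)) =
              fun n : ℕ => (a * ((n : ℤ) + 1)) ^ 0 • (0 : Torus1) := by
            funext n
            rw [hkill n (Nat.ne_of_gt (lt_of_le_of_lt (Nat.zero_le _) h)) (hk d h), smul_zero]
          rw [this, fwdDiff_iter_zpow_smul _ _ (Nat.zero_le _), if_neg (Nat.succ_ne_zero E).symm]
      · simp

/-- The orbits accumulate at every point of the coset determined by the limiting characters. -/
lemma add_mem_closure {y t : Fin L → Torus1}
    (hy : Tendsto (fun k => torusAct (A 0) (x k)) 𝒰 (𝓝 y))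
    (ht : ∀ m ∈ coeffBounded 𝒰 x A, pair m t = 0) :
    y + t ∈ closure (⋃ n ∈ Set.Ici (1 : ℤ), torusAct (evalMat A n) '' Set.range x) := by
  classical
  by_contra hcon
  rw [Metric.mem_closure_iff] at hcon
  push Not at hcon
  obtain ⟨δ, hδ, hfar⟩ := hcon
  obtain ⟨F, b, C, hb, hC, hCb, hpeak⟩ := exists_peak L hδ
  let dif : (Fin L → ℕ) → (Fin L → ℕ) → Fin L → ℤ :=
    fun m m' => (fun i => (m i : ℤ)) - fun i => (m' i : ℤ)
  obtain ⟨j, hj⟩ : ∃ j : ℕ, ∀ m ∈ F, ∀ m' ∈ F,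
      Tendsto (fun q : ℕ × ℕ => avg q.2 fun n => e (pair (dif m m')
        (torusAct (evalMat A (j.factorial * ((n : ℤ) + 1))) (x q.1) - (y + t))))
        ((𝒰 : Filter ℕ).curry atTop)
        (𝓝 (((if dif m m' ∈ coeffBounded 𝒰 x A then 1 else 0 : ℝ)) : ℂ)) := by
    have : ∀ᶠ j : ℕ in atTop, ∀ m ∈ F, ∀ m' ∈ F, _ :=
      (eventually_all_finset F).2 fun m _ => (eventually_all_finset F).2 fun m' _ =>
        eventually_tendsto_avg 𝒰 x A hy ht (dif m m')
    obtain ⟨j, hj⟩ := this.exists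
    refine ⟨j, fun m hm m' hm' => ?_⟩
    split_ifs with h
    · simpa using (hj m hm m' hm').1 h
    · simpa using (hj m hm m' hm').2 h
  set z : ℕ → ℕ → Fin L → Torus1 := fun k n =>
    torusAct (evalMat A (j.factorial * ((n : ℤ) + 1))) (x k) - (y + t) with hz
  have hzfar : ∀ k n, δ ≤ dist (z k n) 0 := by
    intro k n
    have h1 : (1 : ℤ) ≤ j.factorial * ((n : ℤ) + 1) := by
      have : 0 < (j.factorial : ℤ) * ((n : ℤ) + 1) :=
        mul_pos (by exact_mod_cast j.factorial_pos) (by positivity)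
      omega
    have := hfar (torusAct (evalMat A (j.factorial * ((n : ℤ) + 1))) (x k))
      (Set.mem_biUnion (Set.mem_Ici.2 h1) ⟨x k, ⟨k, rfl⟩, rfl⟩)
    rw [hz, dist_zero_right, ← dist_eq_norm]
    rwa [dist_comm] at this
  set g : (Fin L → Torus1) → ℂ :=
    fun w => ∑ m ∈ F, (b m : ℂ) * e (pair (fun i => (m i : ℤ)) w) with hg
  have hgg : ∀ w, g w * conj (g w) =
      ∑ m ∈ F, ∑ m' ∈ F, ((b m : ℂ) * b m') * e (pair (dif m m') w) := by
    intro w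
    simp only [hg, map_sum, Finset.sum_mul_sum, map_mul, Complex.conj_ofReal, dif, pair_sub_left,
      e_sub]
    refine Finset.sum_congr rfl fun m _ => Finset.sum_congr rfl fun m' _ => ?_
    ring
  have hlim : Tendsto (fun q : ℕ × ℕ => avg q.2 fun n => g (z q.1 n) * conj (g (z q.1 n)))
      ((𝒰 : Filter ℕ).curry atTop)
      (𝓝 (∑ m ∈ F, ∑ m' ∈ F, ((b m : ℂ) * b m') *
        (((if dif m m' ∈ coeffBounded 𝒰 x A then 1 else 0 : ℝ)) : ℂ))) := by
    simp only [hgg, avg_sum, avg_const_mul]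
    exact tendsto_finsetSum _ fun m hm => tendsto_finsetSum _ fun m' hm' =>
      (hj m hm m' hm').const_mul _
  have hle : ‖∑ m ∈ F, ∑ m' ∈ F, ((b m : ℂ) * b m') *
        (((if dif m m' ∈ coeffBounded 𝒰 x A then 1 else 0 : ℝ)) : ℂ)‖ ≤ C := by
    have : ((𝒰 : Filter ℕ).curry (atTop : Filter ℕ)).NeBot := by
      rw [neBot_iff]
      intro hbot
      have : ∀ᶠ _q : ℕ × ℕ in (𝒰 : Filter ℕ).curry atTop, False := by rw [hbot]; trivial
      obtain ⟨k, hk⟩ := (eventually_curry_iff.1 this).exists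
      exact hk.exists.choose_spec
    refine le_of_tendsto hlim.norm (Eventually.of_forall fun q => ?_)
    refine norm_avg_le hC fun n => ?_
    rw [norm_mul, RCLike.norm_conj, ← sq]
    exact hpeak _ (hzfar _ _)
  have hge : ∑ m ∈ F, b m ^ 2 ≤ ∑ m ∈ F, ∑ m' ∈ F, (b m * b m') *
      (if dif m m' ∈ coeffBounded 𝒰 x A then 1 else 0 : ℝ) := by
    refine Finset.sum_le_sum fun m hm => ?_
    have h0 : ∀ m' ∈ F, 0 ≤ (b m * b m') *
        (if dif m m' ∈ coeffBounded 𝒰 x A then 1 else 0 : ℝ) := by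
      intro m' _
      have := mul_nonneg (hb m) (hb m')
      split_ifs <;> simp [this]
    refine le_trans (le_of_eq ?_) (Finset.single_le_sum h0 hm)
    have : dif m m ∈ coeffBounded 𝒰 x A := by
      simp only [dif, sub_self]
      exact AddSubgroup.zero_mem _
    rw [if_pos this]; ring
  have hcast : (∑ m ∈ F, ∑ m' ∈ F, ((b m : ℂ) * b m') *
        (((if dif m m' ∈ coeffBounded 𝒰 x A then 1 else 0 : ℝ)) : ℂ)) =
      ((∑ m ∈ F, ∑ m' ∈ F, (b m * b m') *
        (if dif m m' ∈ coeffBounded 𝒰 x A then 1 else 0 : ℝ) : ℝ) : ℂ) := by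
    simp only [Complex.ofReal_sum, Complex.ofReal_mul]
  rw [hcast, Complex.norm_real] at hle
  exact absurd ((hge.trans (le_abs_self _)).trans hle) (not_le.2 hCb)

end density

/-- Some character has coefficients of unbounded order, if the columns of the nonconstant part are
independent and the sequence is injective. -/
lemma exists_notMem_coeffBounded {L N D : ℕ} (A : Fin (D + 1) → Matrix (Fin L) (Fin N) ℤ)
    (ha : CondA A) {x : ℕ → Fin N → Torus1} (hx : Function.Injective x) :
    ∃ m, m ∉ coeffBounded (hyperfilter ℕ) x A := by
  by_contra! hall
  have hrow : ∀ d, d ≠ 0 → ∀ i, A d i ∈ boundedOrder (hyperfilter ℕ) x := by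
    intro d hd i
    have := hall (Pi.single i 1) d hd
    rwa [Matrix.single_one_vecMul] at this
  have hsingle : ∀ j : Fin N, Pi.single j 1 ∈ boundedOrder (hyperfilter ℕ) x := by
    intro j
    by_contra hj
    obtain ⟨w, hw, hwj⟩ := exists_rat_separating _ (boundedOrder_saturated (hyperfilter ℕ) x) hj
    have : w = 0 := ha w fun d hd => by
      ext i
      exact hw _ (hrow d hd i)
    simp [this] at hwj
  choose M hM hMk using hsingle
  have hev : ∀ᶠ k in hyperfilter ℕ, ∀ j, M j • x k j = 0 := by
    rw [eventually_all]
    intro j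
    filter_upwards [hMk j] with k hk
    rwa [pair_single_one] at hk
  have hfin : {u : Fin N → Torus1 | ∀ j, M j • u j = 0}.Finite := by
    have := Set.Finite.pi (t := fun j => {u : Torus1 | M j • u = 0})
      fun j => AddCircle.finite_torsion 1 (hM j)
    refine this.subset fun u hu j _ => hu j
  exact notMem_hyperfilter_of_finite (hfin.preimage hx.injOn) hev

end PolyTorus

/-- **Corollary 2.** If `A(x)` satisfies conditions (a) and (b) and `X ⊆ 𝕋^N` is
infinite, then the closure of `⋃_{n ≥ 1} A(n) X` contains a translate of a
subtorus of `𝕋^L`. -/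
theorem statement18 (L N D : ℕ) (hL : 0 < L) (hN : 0 < N) (hD : 0 < D)
    (A : Fin (D + 1) → Matrix (Fin L) (Fin N) ℤ)
    (ha : CondA A) (hb : CondB A)
    (X : Set (Fin N → Torus1)) (hX : X.Infinite) :
    ∃ T : AddSubgroup (Fin L → Torus1), IsSubtorus T ∧
      ∃ t : Fin L → Torus1,
        translateOf t T ⊆ closure (⋃ n ∈ Set.Ici 1, torusAct (evalMat A n) '' X) := by
  classical
  set x : ℕ → Fin N → Torus1 := fun k => hX.natEmbedding X k with hx
  have hinj : Function.Injective x := fun i j h => (hX.natEmbedding X).injective (Subtype.ext h)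
  obtain ⟨y, -, hy⟩ := isCompact_univ.ultrafilter_le_nhds
    ((hyperfilter ℕ).map fun k => torusAct (A 0) (x k)) (by simp)
  obtain ⟨m, hm⟩ := PolyTorus.exists_notMem_coeffBounded A ha hinj
  obtain ⟨T, hT, hTs⟩ := PolyTorus.exists_subtorus _
    (PolyTorus.coeffBounded_saturated (hyperfilter ℕ) x A) hm
  refine ⟨T, hT, y, ?_⟩
  rintro _ ⟨t, ht, rfl⟩
  refine closure_mono ?_ (PolyTorus.add_mem_closure (hyperfilter ℕ) x A hy (hTs t ht))
  refine Set.iUnion₂_mono fun n _ => Set.image_mono ?_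
  rintro _ ⟨k, rfl⟩
  exact (hX.natEmbedding X k).2
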